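/- arXiv:2508.07715 — 5 statements merged into one kernel-verified Lean document; each statement's English description precedes it below -/
import Mathlib

section
/- For every 3-element subset {i, j, k} ⊆ {1, …, 8}, the polynomial function t ↦ det M_{ijk}(t), where M_{ijk}(t) is the 3×3 complex matrix whose rows are σ_i(t), σ_j(t), σ_k(t), is not identically zero on ℂ; equivalently, for each 3-element subset the set {t ∈ ℂ : σ_i(t), σ_j(t), σ_k(t) are linearly dependent over ℂ} is finite. -/
open Matrix

/-- The eight families of points `σ₁(t), …, σ₈(t)` in `ℂ³` from the proof of
Proposition (prop;def_to_toric). -/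
noncomputable def sigmaPts (i : Fin 8) (t : ℂ) : Fin 3 → ℂ :=
  ![![1, t ^ 5, 0],
    ![t ^ 5, 1, 0],
    ![0, 0, 1],
    ![1, t ^ 2, t],
    ![t ^ 2, 1, t],
    ![t, t ^ 2, 1],
    ![1, t ^ 3, 2 * t],
    ![t ^ 4, 1, 2 * t]] i

/-- The same points over an arbitrary commutative ring. -/
def sigmaGen {R : Type*} [CommRing R] (i : Fin 8) (t : R) : Fin 3 → R :=
  ![![1, t ^ 5, 0],
    ![t ^ 5, 1, 0],
    ![0, 0, 1],
    ![1, t ^ 2, t],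
    ![t ^ 2, 1, t],
    ![t, t ^ 2, 1],
    ![1, t ^ 3, 2 * t],
    ![t ^ 4, 1, 2 * t]] i

/-- Explicit determinant of three of the points. -/
def detGen {R : Type*} [CommRing R] (i j k : Fin 8) (t : R) : R :=
  let a := sigmaGen i t
  let b := sigmaGen j t
  let c := sigmaGen k t
  a 0 * b 1 * c 2 - a 0 * b 2 * c 1 - a 1 * b 0 * c 2 + a 1 * b 2 * c 0
    + a 2 * b 0 * c 1 - a 2 * b 1 * c 0

lemma map_sigmaGen {R S : Type*} [CommRing R] [CommRing S] (f : R →+* S)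
    (i : Fin 8) (m : Fin 3) (t : R) : f (sigmaGen i t m) = sigmaGen i (f t) m := by
  fin_cases i <;> fin_cases m <;> simp [sigmaGen, map_ofNat f 2]

lemma map_detGen {R S : Type*} [CommRing R] [CommRing S] (f : R →+* S)
    (i j k : Fin 8) (t : R) : f (detGen i j k t) = detGen i j k (f t) := by
  simp only [detGen, map_add, map_sub, map_mul, map_sigmaGen]

lemma detGen_int_ne : ∀ i j k : Fin 8, i ≠ j → i ≠ k → j ≠ k →
    detGen i j k (3 : ℤ) ≠ 0 := by
  decide +kernel

/-- For every choice of three distinct indices `i, j, k ∈ {1, …, 8}`, the polynomial function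
`t ↦ det M_{ijk}(t)` (rows `σᵢ(t), σⱼ(t), σₖ(t)`) is not identically zero; equivalently, the
set of `t ∈ ℂ` where `σᵢ(t), σⱼ(t), σₖ(t)` are linearly dependent over `ℂ` is finite. -/
theorem sigma_three_det_not_identically_zero
    (i j k : Fin 8) (hij : i ≠ j) (hik : i ≠ k) (hjk : j ≠ k) :
    {t : ℂ | (Matrix.of ![sigmaPts i t, sigmaPts j t, sigmaPts k t]).det = 0}.Finite := by
  have hne : detGen i j k (Polynomial.X : Polynomial ℂ) ≠ 0 := by
    intro h
    have h1 := map_detGen (Polynomial.evalRingHom (3 : ℂ)) i j k Polynomial.X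
    have h2 := map_detGen (Int.castRingHom ℂ) i j k 3
    rw [h] at h1
    simp only [map_zero, Polynomial.coe_evalRingHom, Polynomial.eval_X] at h1
    simp only [eq_intCast, Int.cast_ofNat] at h2
    rw [← h1] at h2
    exact detGen_int_ne i j k hij hik hjk (by exact_mod_cast h2)
  refine (Polynomial.finite_setOfPred_isRoot hne).subset ?_
  intro t ht
  have h1 := map_detGen (Polynomial.evalRingHom t) i j k Polynomial.X
  simp only [Polynomial.coe_evalRingHom, Polynomial.eval_X] at h1
  rw [Set.mem_ofPred_eq, Matrix.det_fin_three] at ht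
  rw [Set.mem_ofPred_eq, Polynomial.IsRoot.def, h1]
  exact ht
end

section
/- For all but finitely many t ∈ ℂ, no three of the eight points represented by σ₁(t), …, σ₈(t) in ℙ²(ℂ) are collinear: for every choice of three distinct indices i, j, k ∈ {1, …, 8}, the vectors σ_i(t), σ_j(t), σ_k(t) are linearly independent over ℂ. In particular, for all but finitely many t the eight points are pairwise distinct. -/
open Matrix

/-- The same points over an arbitrary commutative ring. -/
def genPts {R : Type} [CommRing R] (i : Fin 8) (t : R) : Fin 3 → R :=
  ![![1, t ^ 5, 0],
    ![t ^ 5, 1, 0],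
    ![0, 0, 1],
    ![1, t ^ 2, t],
    ![t ^ 2, 1, t],
    ![t, t ^ 2, 1],
    ![1, t ^ 3, 2 * t],
    ![t ^ 4, 1, 2 * t]] i

/-- The explicit 3×3 determinant of three of the points. -/
def genDet {R : Type} [CommRing R] (i j k : Fin 8) (t : R) : R :=
  genPts i t 0 * (genPts j t 1 * genPts k t 2 - genPts j t 2 * genPts k t 1)
  - genPts i t 1 * (genPts j t 0 * genPts k t 2 - genPts j t 2 * genPts k t 0)
  + genPts i t 2 * (genPts j t 0 * genPts k t 1 - genPts j t 1 * genPts k t 0)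

lemma map_genPts {R S : Type} [CommRing R] [CommRing S] (φ : R →+* S) (i : Fin 8) (t : R)
    (a : Fin 3) : φ (genPts i t a) = genPts i (φ t) a := by
  fin_cases i <;> fin_cases a <;> simp [genPts, map_ofNat φ 2]

lemma map_genDet {R S : Type} [CommRing R] [CommRing S] (φ : R →+* S) (i j k : Fin 8) (t : R) :
    φ (genDet i j k t) = genDet i j k (φ t) := by
  simp only [genDet, map_add, map_sub, map_mul, map_genPts]

lemma genDet_int : ∀ i j k : Fin 8, i ≠ j → i ≠ k → j ≠ k → genDet i j k (2 : ℤ) ≠ 0 := by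
  decide +kernel

lemma genDet_poly_ne_zero (i j k : Fin 8) (hij : i ≠ j) (hik : i ≠ k) (hjk : j ≠ k) :
    genDet i j k (Polynomial.X : Polynomial ℂ) ≠ 0 := by
  intro h
  have h1 := map_genDet (Polynomial.evalRingHom (2 : ℂ)) i j k Polynomial.X
  have h2 := map_genDet (Int.castRingHom ℂ) i j k 2
  rw [h] at h1
  simp only [map_zero, Polynomial.coe_evalRingHom, Polynomial.eval_X] at h1
  simp only [eq_intCast, Int.cast_ofNat] at h2
  rw [← h1] at h2
  exact genDet_int i j k hij hik hjk (by exact_mod_cast h2)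

lemma exists_third : ∀ i j : Fin 8, ∃ k : Fin 8, i ≠ k ∧ j ≠ k := by
  decide

lemma linInd_of_genDet (i j k : Fin 8) (t : ℂ) (h : genDet i j k t ≠ 0) :
    LinearIndependent ℂ ![sigmaPts i t, sigmaPts j t, sigmaPts k t] := by
  have hd : (Matrix.of ![sigmaPts i t, sigmaPts j t, sigmaPts k t]).det ≠ 0 := by
    intro h0
    apply h
    rw [← h0, Matrix.det_fin_three]
    change genDet i j k t = genPts i t 0 * genPts j t 1 * genPts k t 2
      - genPts i t 0 * genPts j t 2 * genPts k t 1
      - genPts i t 1 * genPts j t 0 * genPts k t 2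
      + genPts i t 1 * genPts j t 2 * genPts k t 0
      + genPts i t 2 * genPts j t 0 * genPts k t 1
      - genPts i t 2 * genPts j t 1 * genPts k t 0
    unfold genDet
    ring
  exact Matrix.linearIndependent_rows_of_det_ne_zero hd

/-- For all but finitely many `t ∈ ℂ`, no three of the eight points represented by
`σ₁(t), …, σ₈(t)` are collinear: any three vectors with distinct indices are linearly
independent over `ℂ`.  In particular, for all but finitely many `t` the eight projective
points are pairwise distinct (no vector is a scalar multiple of another). -/
theorem sigma_no_three_collinear_generic :
    {t : ℂ | ¬ ((∀ i j k : Fin 8, i ≠ j → i ≠ k → j ≠ k →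
        LinearIndependent ℂ ![sigmaPts i t, sigmaPts j t, sigmaPts k t]) ∧
      (∀ i j : Fin 8, i ≠ j → ∀ c : ℂ, sigmaPts i t ≠ c • sigmaPts j t))}.Finite := by
  have hfin : (⋃ i : Fin 8, ⋃ j : Fin 8, ⋃ k : Fin 8,
      {t : ℂ | (i ≠ j ∧ i ≠ k ∧ j ≠ k) ∧ genDet i j k t = 0}).Finite := by
    refine Set.finite_iUnion fun i => Set.finite_iUnion fun j => Set.finite_iUnion fun k => ?_
    by_cases hd : i ≠ j ∧ i ≠ k ∧ j ≠ k
    · refine (Polynomial.finite_setOfPred_isRoot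
        (genDet_poly_ne_zero i j k hd.1 hd.2.1 hd.2.2)).subset ?_
      rintro t ⟨-, ht⟩
      have h1 := map_genDet (Polynomial.evalRingHom t) i j k Polynomial.X
      simp only [Polynomial.coe_evalRingHom, Polynomial.eval_X] at h1
      exact h1.trans ht
    · simp [hd]
  refine hfin.subset ?_
  intro t ht
  by_contra hn
  apply ht
  have key : ∀ i j k : Fin 8, i ≠ j → i ≠ k → j ≠ k →
      LinearIndependent ℂ ![sigmaPts i t, sigmaPts j t, sigmaPts k t] := by
    intro i j k hij hik hjk
    apply linInd_of_genDet
    intro h0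
    apply hn
    simp only [Set.mem_iUnion]
    exact ⟨i, j, k, ⟨hij, hik, hjk⟩, h0⟩
  refine ⟨key, ?_⟩
  intro i j hij c hc
  obtain ⟨k, hik, hjk⟩ : ∃ k : Fin 8, i ≠ k ∧ j ≠ k :=
    exists_third i j
  have h := Fintype.linearIndependent_iff.1 (key i j k hij hik hjk) ![1, -c, 0]
    (by simp [Fin.sum_univ_three, hc]) 0
  simp at h
end

section
/- For all but finitely many t ∈ ℂ, no six of the eight points represented by σ₁(t), …, σ₈(t) in ℙ²(ℂ) lie on a common conic: for every 6-element subset S ⊆ {1, …, 8}, every homogeneous polynomial P ∈ ℂ[X, Y, Z] of degree 2 satisfying P(σ_i(t)) = 0 for all i ∈ S is the zero polynomial. -/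
/-- The exponents of the six monomials of degree two in three variables. -/
def conicExp (j : Fin 6) : Fin 3 → ℕ :=
  ![![2, 0, 0], ![0, 2, 0], ![0, 0, 2], ![1, 1, 0], ![1, 0, 1], ![0, 1, 1]] j

/-- The same exponents as finitely supported functions. -/
noncomputable def conicMon (j : Fin 6) : Fin 3 →₀ ℕ :=
  Finsupp.equivFunOnFinite.symm (conicExp j)

lemma conicMon_inj : Function.Injective conicMon := by
  intro a b h
  have h' : conicExp a = conicExp b := Finsupp.equivFunOnFinite.symm.injective h
  clear h
  revert h'
  revert a b
  decide

lemma conicMon_surj (d : Fin 3 →₀ ℕ) (hd : d.degree = 2) : ∃ j, conicMon j = d := by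
  have h : d 0 + d 1 + d 2 = 2 := by
    rwa [Finsupp.degree_eq_sum, Fin.sum_univ_three] at hd
  have key : ∃ j, conicExp j = fun i => d i := by
    have h0 : d 0 ≤ 2 := by omega
    have h1 : d 1 ≤ 2 := by omega
    have e : (fun i => d i) = ![d 0, d 1, d 2] := by
      ext i; fin_cases i <;> rfl
    rw [e]
    have h2 : d 2 = 2 - d 0 - d 1 := by omega
    rw [h2]
    have h3 : d 0 + d 1 ≤ 2 := by omega
    generalize d 0 = x at *
    generalize d 1 = y at *
    clear e h h2
    interval_cases x <;> interval_cases y <;> first | omega | decide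
  obtain ⟨j, hj⟩ := key
  refine ⟨j, ?_⟩
  ext i
  exact congrFun hj i

lemma conic_eval (P : MvPolynomial (Fin 3) ℂ) (hP : P.IsHomogeneous 2) (v : Fin 3 → ℂ) :
    MvPolynomial.eval v P =
      ∑ j, (∏ k, v k ^ conicExp j k) * P.coeff (conicMon j) := by
  classical
  rw [MvPolynomial.eval_eq']
  have hsub : P.support ⊆ Finset.univ.image conicMon := by
    intro d hd
    have h2 : d.degree = 2 := by
      rw [Finsupp.degree_eq_weight_one]
      exact hP (MvPolynomial.mem_support_iff.mp hd)
    obtain ⟨j, hj⟩ := conicMon_surj d h2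
    exact Finset.mem_image.mpr ⟨j, Finset.mem_univ _, hj⟩
  rw [Finset.sum_subset hsub]
  · rw [Finset.sum_image (fun a _ b _ h => conicMon_inj h)]
    refine Finset.sum_congr rfl fun j _ => ?_
    rw [mul_comm]
    rfl
  · intro d _ hd
    rw [MvPolynomial.notMem_support_iff.mp hd, zero_mul]

lemma conic_zero (P : MvPolynomial (Fin 3) ℂ) (hP : P.IsHomogeneous 2)
    (h : ∀ j, P.coeff (conicMon j) = 0) : P = 0 := by
  ext d
  rw [MvPolynomial.coeff_zero]
  by_contra hd
  have h2 : d.degree = 2 := by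
    rw [Finsupp.degree_eq_weight_one]
    exact hP hd
  obtain ⟨j, rfl⟩ := conicMon_surj d h2
  exact hd (h j)

/-- The families of points, with polynomial coordinates. -/
noncomputable def sigmaPoly (i : Fin 8) : Fin 3 → Polynomial ℂ :=
  ![![1, Polynomial.X ^ 5, 0],
    ![Polynomial.X ^ 5, 1, 0],
    ![0, 0, 1],
    ![1, Polynomial.X ^ 2, Polynomial.X],
    ![Polynomial.X ^ 2, 1, Polynomial.X],
    ![Polynomial.X, Polynomial.X ^ 2, 1],
    ![1, Polynomial.X ^ 3, 2 * Polynomial.X],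
    ![Polynomial.X ^ 4, 1, 2 * Polynomial.X]] i

lemma sigmaPoly_eval (i : Fin 8) (t : ℂ) (k : Fin 3) :
    (sigmaPoly i k).eval t = sigmaPts i t k := by
  fin_cases i <;> fin_cases k <;> simp [sigmaPoly, sigmaPts]

/-- The matrix of the linear conditions imposed on conics by six of the points. -/
noncomputable def conicMat (f : Fin 6 → Fin 8) (t : ℂ) : Matrix (Fin 6) (Fin 6) ℂ :=
  Matrix.of fun i j => ∏ k, sigmaPts (f i) t k ^ conicExp j k

/-- Its determinant as a polynomial in the parameter. -/
noncomputable def conicDet (f : Fin 6 → Fin 8) : Polynomial ℂ :=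
  Matrix.det (Matrix.of fun i j => ∏ k, sigmaPoly (f i) k ^ conicExp j k)

lemma conicDet_eval (f : Fin 6 → Fin 8) (t : ℂ) :
    (conicDet f).eval t = (conicMat f t).det := by
  rw [conicDet, ← Polynomial.coe_evalRingHom, RingHom.map_det]
  congr 1
  ext i j
  simp [conicMat, Polynomial.eval_prod, sigmaPoly_eval]

/-- Generators of the linear relations between the eight conditions at `t = 2`. -/
def relA : Fin 8 → ℤ :=
  ![-19733, -16072, 286440, -10889494, 853864, 2848032, 2313003, 0]

/-- Second generator of the relations at `t = 2`. -/
def relB : Fin 8 → ℤ :=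
  ![-41482, -123221, 15195642, 221650, -8716642, 2923734, 0, 991287]

lemma rel_minor : ∀ a b : Fin 8, a ≠ b → relA a * relB b - relA b * relB a ≠ 0 := by
  decide

lemma two_zero (y : Fin 8 → ℂ) (hA : ∑ i, (relA i : ℂ) * y i = 0)
    (hB : ∑ i, (relB i : ℂ) * y i = 0) (a b : Fin 8) (hab : a ≠ b)
    (h : ∀ i, i ≠ a → i ≠ b → y i = 0) : y a = 0 := by
  have red : ∀ r : Fin 8 → ℤ, ∑ i, (r i : ℂ) * y i = r a * y a + r b * y b := by
    intro r
    rw [← Finset.sum_pair (f := fun i => (r i : ℂ) * y i) hab]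
    symm
    apply Finset.sum_subset (Finset.subset_univ _)
    intro i _ hi
    simp only [Finset.mem_insert, Finset.mem_singleton, not_or] at hi
    rw [h i hi.1 hi.2, mul_zero]
  rw [red] at hA hB
  have hm : ((relA a : ℂ) * relB b - relA b * relB a) ≠ 0 := by
    exact_mod_cast rel_minor a b hab
  have : ((relA a : ℂ) * relB b - relA b * relB a) * y a = 0 := by
    linear_combination (relB b : ℂ) * hA - (relA b : ℂ) * hB
  exact (mul_eq_zero.mp this).resolve_left hm

/-- The values of a conic with coefficients `c` at the eight points with `t = 2`. -/
noncomputable def conicVal (c : Fin 6 → ℂ) (i : Fin 8) : ℂ :=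
  ∑ j, (∏ k, sigmaPts i 2 k ^ conicExp j k) * c j

lemma conicVal_eq (c : Fin 6 → ℂ) : conicVal c =
    ![c 0 + 1024 * c 1 + 32 * c 3,
      1024 * c 0 + c 1 + 32 * c 3,
      c 2,
      c 0 + 16 * c 1 + 4 * c 2 + 4 * c 3 + 2 * c 4 + 8 * c 5,
      16 * c 0 + c 1 + 4 * c 2 + 4 * c 3 + 8 * c 4 + 2 * c 5,
      4 * c 0 + 16 * c 1 + c 2 + 8 * c 3 + 2 * c 4 + 4 * c 5,
      c 0 + 64 * c 1 + 16 * c 2 + 8 * c 3 + 4 * c 4 + 32 * c 5,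
      256 * c 0 + c 1 + 16 * c 2 + 16 * c 3 + 64 * c 4 + 4 * c 5] := by
  ext i
  fin_cases i <;>
    simp [conicVal, sigmaPts, conicExp, Fin.sum_univ_six, Fin.prod_univ_three] <;> ring

lemma conicVal_inj (c : Fin 6 → ℂ) (h : conicVal c = 0) : c = 0 := by
  rw [conicVal_eq] at h
  have h0 := congrFun h 0
  have h1 := congrFun h 1
  have h2 := congrFun h 2
  have h3 := congrFun h 3
  have h4 := congrFun h 4
  have h5 := congrFun h 5
  simp at h0 h1 h2 h3 h4 h5
  ext j
  fin_cases j <;> simp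
  · linear_combination (47/991287) * h0 + (976/991287) * h1 - (8/969) * h2 + (8/2907) * h3
      + (16/20349) * h4 - (40/6783) * h5
  · linear_combination (1016/991287) * h0 + (7/991287) * h1 - (8/969) * h2 + (8/2907) * h3
      + (16/20349) * h4 - (40/6783) * h5
  · linear_combination h2
  · linear_combination (-6143/3965148) * h0 - (509/1982574) * h1 + (1025/3876) * h2
      - (1025/11628) * h3 - (1025/40698) * h4 + (5125/27132) * h5
  · linear_combination (922/991287) * h0 - (1945/991287) * h1 - (953/1938) * h2
      - (8/2907) * h3 + (413/2907) * h4 - (127/1938) * h5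
  · linear_combination (-3001/1982574) * h0 + (955/1982574) * h1 - (953/1938) * h2
      + (953/5814) * h3 - (143/5814) * h4 - (127/1938) * h5

lemma conicVal_relA (c : Fin 6 → ℂ) : ∑ i, (relA i : ℂ) * conicVal c i = 0 := by
  rw [conicVal_eq]
  simp [Fin.sum_univ_eight, relA]
  ring

lemma conicVal_relB (c : Fin 6 → ℂ) : ∑ i, (relB i : ℂ) * conicVal c i = 0 := by
  rw [conicVal_eq]
  simp [Fin.sum_univ_eight, relB]
  ring

lemma compl_pair (f : Fin 6 → Fin 8) (hf : Function.Injective f) (a : Fin 8)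
    (ha : ∀ i, f i ≠ a) : ∃ b, a ≠ b ∧ ∀ x, x ≠ a → x ≠ b → ∃ i, f i = x := by
  have hcard : (Finset.univ.image f)ᶜ.card = 2 := by
    rw [Finset.card_compl, Finset.card_image_of_injective _ hf]
    simp
  obtain ⟨u, v, huv, he⟩ := Finset.card_eq_two.mp hcard
  have hmem : ∀ x, (∀ i, f i ≠ x) ↔ x = u ∨ x = v := by
    intro x
    have : x ∈ (Finset.univ.image f)ᶜ ↔ x ∈ ({u, v} : Finset (Fin 8)) := by rw [he]
    simpa using this
  have hex : ∀ x, x ≠ u → x ≠ v → ∃ i, f i = x := by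
    intro x hu hv
    by_contra hn
    push Not at hn
    rcases (hmem x).mp hn with h | h
    · exact hu h
    · exact hv h
  rcases (hmem a).mp ha with rfl | rfl
  · exact ⟨v, huv, hex⟩
  · exact ⟨u, huv.symm, fun x h1 h2 => hex x h2 h1⟩

lemma conicDet_ne_zero (f : Fin 6 → Fin 8) (hf : Function.Injective f) : conicDet f ≠ 0 := by
  intro h0
  have hdet : (conicMat f 2).det = 0 := by rw [← conicDet_eval, h0, Polynomial.eval_zero]
  obtain ⟨c, hc, hM⟩ := Matrix.exists_mulVec_eq_zero_iff.mpr hdet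
  apply hc
  apply conicVal_inj
  have hz : ∀ i, conicVal c (f i) = 0 := fun i => congrFun hM i
  ext a
  by_cases ha : ∃ i, f i = a
  · obtain ⟨i, rfl⟩ := ha
    exact hz i
  · push Not at ha
    obtain ⟨b, hab, hb⟩ := compl_pair f hf a ha
    refine two_zero _ (conicVal_relA c) (conicVal_relB c) a b hab fun x h1 h2 => ?_
    obtain ⟨i, rfl⟩ := hb x h1 h2
    exact hz i

/-- For all but finitely many `t ∈ ℂ`, no six of the eight points represented by
`σ₁(t), …, σ₈(t)` lie on a common conic: for every 6-element subset (encoded by an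
injection `Fin 6 ↪ Fin 8`), every homogeneous polynomial `P ∈ ℂ[X, Y, Z]` of degree 2
vanishing at `σᵢ(t)` for all `i` in the subset is the zero polynomial. -/
theorem sigma_no_six_on_conic_generic :
    {t : ℂ | ¬ (∀ f : Fin 6 → Fin 8, Function.Injective f →
        ∀ P : MvPolynomial (Fin 3) ℂ, P.IsHomogeneous 2 →
          (∀ i : Fin 6, MvPolynomial.eval (sigmaPts (f i) t) P = 0) →
          P = 0)}.Finite := by
  have hfin : (⋃ f ∈ {f : Fin 6 → Fin 8 | Function.Injective f},
      {t : ℂ | (conicDet f).IsRoot t}).Finite := by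
    refine Set.Finite.biUnion (Set.toFinite _) fun f hf => ?_
    exact Polynomial.finite_setOfPred_isRoot (conicDet_ne_zero f hf)
  refine hfin.subset fun t ht => ?_
  by_contra hn
  apply ht
  intro f hf P hP hv
  apply conic_zero P hP
  have hdet : (conicMat f t).det ≠ 0 := by
    intro h
    apply hn
    refine Set.mem_biUnion (x := f) hf ?_
    change (conicDet f).eval t = 0
    rw [conicDet_eval, h]
  have hc : (fun j => P.coeff (conicMon j)) = 0 := by
    apply Matrix.eq_zero_of_mulVec_eq_zero hdet
    ext i
    have := hv i
    rw [conic_eval P hP] at this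
    exact this
  exact fun j => congrFun hc j
end

section
/- For each fixed index j ∈ {1, …, 8}, for all but finitely many t ∈ ℂ the following holds: there is no nonzero homogeneous polynomial P ∈ ℂ[X, Y, Z] of degree 3 such that P(σ_i(t)) = 0 for all i ∈ {1, …, 8} and such that all three partial derivatives ∂P/∂X, ∂P/∂Y, ∂P/∂Z vanish at σ_j(t). In other words, for generic t no cubic curve passes through all eight points with a double (singular) point at the j-th point. -/
/-- The eight families of points over an arbitrary commutative ring. -/
def sigR {R : Type*} [CommRing R] (i : Fin 8) (t : R) : Fin 3 → R :=
  ![![1, t ^ 5, 0],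
    ![t ^ 5, 1, 0],
    ![0, 0, 1],
    ![1, t ^ 2, t],
    ![t ^ 2, 1, t],
    ![t, t ^ 2, 1],
    ![1, t ^ 3, 2 * t],
    ![t ^ 4, 1, 2 * t]] i

/-- Values of the ten cubic monomials. -/
def evRow {R : Type*} [CommRing R] (v : Fin 3 → R) : Fin 10 → R :=
  ![v 0 ^ 3, v 0 ^ 2 * v 1, v 0 ^ 2 * v 2, v 0 * v 1 ^ 2, v 0 * v 1 * v 2, v 0 * v 2 ^ 2,
    v 1 ^ 3, v 1 ^ 2 * v 2, v 1 * v 2 ^ 2, v 2 ^ 3]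

/-- Values of the partial derivatives of the ten cubic monomials. -/
def dRow {R : Type*} [CommRing R] (k : Fin 3) (v : Fin 3 → R) : Fin 10 → R :=
  ![![3 * v 0 ^ 2, 2 * v 0 * v 1, 2 * v 0 * v 2, v 1 ^ 2, v 1 * v 2, v 2 ^ 2, 0, 0, 0, 0],
    ![0, v 0 ^ 2, 0, 2 * v 0 * v 1, v 0 * v 2, 0, 3 * v 1 ^ 2, 2 * v 1 * v 2, v 2 ^ 2, 0],
    ![0, 0, v 0 ^ 2, 0, v 0 * v 1, 2 * v 0 * v 2, 0, v 1 ^ 2, 2 * v 1 * v 2, 3 * v 2 ^ 2]] k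

/-- The matrix of the linear conditions (the condition of vanishing at the `j`-th point is
replaced by the three derivative conditions). -/
def condMat {R : Type*} [CommRing R] (j : Fin 8) (t : R) : Matrix (Fin 10) (Fin 10) R :=
  fun r => if r.val = j.val then dRow 0 (sigR j t)
    else if h : r.val < 8 then evRow (sigR ⟨r.val, h⟩ t)
    else if r.val = 8 then dRow 1 (sigR j t) else dRow 2 (sigR j t)

/-- Inverses of the condition matrices at a sample parameter modulo a small prime. -/
def condInv (j : Fin 8) : Matrix (Fin 10) (Fin 10) (ZMod 13) :=
  ![![![3, 0, 10, 2, 4, 3, 7, 2, 4, 3],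
    ![6, 12, 6, 9, 5, 7, 12, 9, 2, 7],
    ![12, 11, 0, 9, 12, 4, 7, 9, 6, 11],
    ![5, 9, 8, 12, 11, 5, 3, 12, 12, 5],
    ![12, 5, 6, 11, 12, 11, 0, 6, 3, 10],
    ![9, 9, 6, 2, 8, 9, 12, 5, 5, 9],
    ![3, 9, 7, 4, 8, 6, 1, 4, 6, 6],
    ![2, 5, 12, 12, 2, 6, 11, 2, 8, 6],
    ![9, 9, 6, 6, 7, 0, 10, 9, 12, 11],
    ![0, 0, 1, 0, 0, 0, 0, 0, 0, 0]],
  ![![9, 5, 2, 2, 9, 5, 7, 10, 8, 8],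
    ![9, 9, 6, 6, 1, 2, 8, 4, 7, 11],
    ![2, 7, 7, 2, 1, 9, 2, 12, 8, 10],
    ![12, 3, 11, 11, 4, 8, 6, 3, 1, 5],
    ![12, 9, 6, 3, 10, 2, 11, 10, 1, 12],
    ![9, 10, 2, 9, 9, 0, 4, 12, 0, 0],
    ![0, 10, 1, 1, 11, 9, 10, 5, 12, 4],
    ![12, 6, 11, 1, 8, 2, 5, 2, 5, 11],
    ![12, 2, 2, 1, 5, 10, 12, 9, 12, 5],
    ![0, 0, 1, 0, 0, 0, 0, 0, 0, 0]],
  ![![7, 8, 3, 2, 0, 2, 7, 9, 12, 8],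
    ![5, 12, 3, 8, 2, 6, 6, 8, 10, 2],
    ![2, 4, 6, 11, 2, 2, 6, 0, 2, 10],
    ![6, 6, 8, 3, 5, 11, 1, 2, 1, 2],
    ![10, 5, 8, 4, 4, 4, 10, 12, 5, 2],
    ![0, 0, 1, 0, 0, 0, 0, 0, 0, 0],
    ![1, 2, 2, 3, 2, 1, 8, 5, 6, 8],
    ![9, 6, 0, 4, 10, 6, 2, 3, 10, 10],
    ![0, 0, 0, 0, 0, 0, 0, 0, 1, 0],
    ![0, 0, 0, 0, 0, 0, 0, 0, 0, 9]],
  ![![8, 2, 1, 10, 10, 10, 10, 10, 12, 6],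
    ![2, 11, 4, 8, 2, 10, 4, 12, 3, 1],
    ![12, 8, 7, 0, 3, 0, 9, 9, 11, 0],
    ![3, 9, 8, 0, 11, 5, 3, 10, 3, 10],
    ![2, 11, 5, 4, 4, 6, 9, 1, 8, 7],
    ![1, 8, 4, 11, 5, 12, 4, 2, 11, 11],
    ![2, 3, 8, 9, 3, 11, 5, 0, 12, 12],
    ![3, 7, 3, 4, 8, 0, 1, 1, 8, 0],
    ![2, 4, 9, 2, 5, 2, 9, 5, 2, 11],
    ![0, 0, 1, 0, 0, 0, 0, 0, 0, 0]],
  ![![11, 5, 6, 2, 4, 10, 7, 7, 11, 5],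
    ![9, 6, 5, 3, 12, 8, 5, 10, 5, 9],
    ![10, 4, 12, 8, 0, 4, 8, 1, 10, 6],
    ![8, 10, 7, 10, 9, 0, 5, 11, 10, 6],
    ![12, 2, 12, 8, 10, 5, 3, 0, 10, 0],
    ![10, 6, 2, 3, 12, 8, 11, 3, 12, 7],
    ![8, 10, 3, 11, 2, 9, 7, 12, 10, 3],
    ![9, 8, 10, 3, 4, 10, 7, 9, 2, 2],
    ![0, 8, 11, 9, 6, 3, 7, 11, 12, 3],
    ![0, 0, 1, 0, 0, 0, 0, 0, 0, 0]],
  ![![4, 11, 11, 2, 11, 10, 7, 12, 2, 7],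
    ![7, 7, 0, 0, 0, 6, 9, 12, 4, 7],
    ![12, 0, 3, 1, 11, 6, 0, 4, 8, 3],
    ![4, 7, 4, 9, 4, 8, 2, 6, 6, 10],
    ![11, 9, 3, 0, 3, 8, 5, 1, 12, 6],
    ![9, 11, 1, 10, 8, 4, 6, 3, 9, 11],
    ![4, 9, 5, 8, 5, 7, 11, 8, 12, 9],
    ![10, 7, 8, 5, 10, 7, 0, 11, 3, 0],
    ![4, 4, 3, 4, 0, 12, 5, 6, 6, 5],
    ![0, 0, 1, 0, 0, 0, 0, 0, 0, 0]],
  ![![11, 6, 3, 7, 4, 4, 11, 4, 0, 0],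
    ![7, 7, 0, 0, 0, 1, 8, 9, 2, 11],
    ![1, 6, 10, 8, 9, 7, 3, 4, 4, 8],
    ![3, 4, 7, 12, 5, 1, 11, 8, 5, 8],
    ![11, 9, 3, 0, 3, 8, 2, 6, 11, 4],
    ![6, 2, 10, 6, 11, 4, 12, 6, 6, 10],
    ![6, 2, 12, 2, 3, 4, 0, 12, 2, 11],
    ![6, 8, 7, 4, 1, 2, 1, 12, 8, 6],
    ![1, 8, 12, 0, 3, 10, 10, 10, 2, 9],
    ![0, 0, 1, 0, 0, 0, 0, 0, 0, 0]],
  ![![10, 10, 9, 2, 1, 9, 7, 0, 5, 12],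
    ![7, 7, 0, 0, 0, 4, 12, 10, 8, 11],
    ![10, 9, 8, 1, 10, 8, 7, 12, 6, 8],
    ![5, 9, 8, 9, 11, 5, 3, 12, 10, 10],
    ![11, 9, 3, 0, 3, 3, 0, 0, 11, 1],
    ![12, 4, 0, 10, 3, 6, 12, 6, 3, 5],
    ![2, 5, 10, 8, 4, 1, 1, 10, 2, 7],
    ![1, 2, 11, 5, 12, 12, 11, 0, 6, 11],
    ![7, 10, 2, 4, 8, 11, 10, 1, 7, 2],
    ![0, 0, 1, 0, 0, 0, 0, 0, 0, 0]]] j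

lemma cond_mul_inv_aux : ∀ x : Fin 8 × Fin 10 × Fin 10,
    (∑ k, condMat x.1 (2 : ZMod 13) x.2.1 k * condInv x.1 k x.2.2 : ZMod 13) =
      if x.2.1 = x.2.2 then 1 else 0 := by
  decide +kernel

lemma cond_mul_inv (j : Fin 8) (a b : Fin 10) : (condMat j (2 : ZMod 13) * condInv j) a b =
    (1 : Matrix (Fin 10) (Fin 10) (ZMod 13)) a b := by
  rw [Matrix.mul_apply, Matrix.one_apply]
  exact cond_mul_inv_aux (j, a, b)

lemma condMat_map {R S : Type*} [CommRing R] [CommRing S] (f : R →+* S) (j : Fin 8) (t : R) :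
    f.mapMatrix (condMat j t) = condMat j (f t) := by
  have hs : ∀ (i : Fin 8) (k : Fin 3), f (sigR i t k) = sigR i (f t) k := by
    intro i k; fin_cases i <;> fin_cases k <;> simp [sigR, map_ofNat f 2]
  have he : ∀ (v : Fin 3 → R) (k : Fin 10), f (evRow v k) = evRow (fun i => f (v i)) k := by
    intro v k; fin_cases k <;> simp [evRow]
  have hd : ∀ (l : Fin 3) (v : Fin 3 → R) (k : Fin 10),
      f (dRow l v k) = dRow l (fun i => f (v i)) k := by
    intro l v k; fin_cases l <;> fin_cases k <;> simp [dRow, map_ofNat f 2, map_ofNat f 3]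
  ext r c
  simp only [RingHom.mapMatrix_apply, Matrix.map_apply, condMat]
  split_ifs <;> simp [he, hd, hs]

open Polynomial in
lemma det_ne (j : Fin 8) : (condMat j (X : ℤ[X])).det ≠ 0 := by
  intro h
  have h1 := congrArg (eval₂RingHom (Int.castRingHom (ZMod 13)) (2 : ZMod 13)) h
  rw [RingHom.map_det, condMat_map, map_zero] at h1
  have h2 : condMat j (2 : ZMod 13) * condInv j = 1 := by
    ext a b; exact cond_mul_inv j a b
  have h3 := congrArg Matrix.det h2
  rw [Matrix.det_mul, Matrix.det_one] at h3
  simp only [coe_eval₂RingHom, eval₂_X] at h1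
  rw [h1, zero_mul] at h3
  exact absurd h3 (by decide)

open Polynomial in
lemma det_finite (j : Fin 8) : {t : ℂ | (condMat j t).det = 0}.Finite := by
  have h0 : (condMat j (X : ℤ[X])).det.map (Int.castRingHom ℂ) ≠ 0 := by
    rw [Ne, Polynomial.map_eq_zero_iff (Int.cast_injective)]
    exact det_ne j
  refine (Polynomial.finite_setOfPred_isRoot h0).subset ?_
  intro t ht
  have h1 := RingHom.map_det (eval₂RingHom (Int.castRingHom ℂ) t) (condMat j (X : ℤ[X]))
  rw [condMat_map] at h1
  simp only [coe_eval₂RingHom, eval₂_X] at h1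
  simp only [Set.mem_ofPred_eq, IsRoot.def, eval_map] at ht ⊢
  rw [h1, ht]

open MvPolynomial in
lemma cubic_expand (P : MvPolynomial (Fin 3) ℂ) (hP : P.IsHomogeneous 3) :
    ∃ c : Fin 10 → ℂ, P = ∑ k, C (c k) * evRow (R := MvPolynomial (Fin 3) ℂ) X k := by
  let p : Submodule ℂ (MvPolynomial (Fin 3) ℂ) :=
    Submodule.span ℂ (Set.range (evRow (R := MvPolynomial (Fin 3) ℂ) X))
  have hm : P ∈ p := by
    rw [P.as_sum]
    refine Submodule.sum_mem _ fun d hd => ?_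
    have hdeg : d 0 + d 1 + d 2 = 3 := by
      have := hP (mem_support_iff.mp hd)
      rw [Finsupp.weight_apply, Finsupp.sum_fintype _ _ (by simp)] at this
      simpa [Fin.sum_univ_three] using this
    have e : monomial d (coeff d P) = coeff d P • (X 0 ^ d 0 * X 1 ^ d 1 * X 2 ^ d 2 :
        MvPolynomial (Fin 3) ℂ) := by
      rw [monomial_eq, smul_eq_C_mul, Finsupp.prod_fintype _ _ (by simp), Fin.prod_univ_three]
    rw [e]
    refine Submodule.smul_mem _ _ (Submodule.subset_span ?_)
    have b0 : d 0 ≤ 3 := by omega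
    have b1 : d 1 ≤ 3 := by omega
    have b2 : d 2 = 3 - d 0 - d 1 := by omega
    rw [b2]
    have b3 : d 0 + d 1 ≤ 3 := by omega
    generalize d 0 = a at *
    generalize d 1 = b at *
    interval_cases a <;> interval_cases b <;> first | omega | skip
    · exact ⟨9, by simp [evRow]⟩
    · exact ⟨8, by simp [evRow]⟩
    · exact ⟨7, by simp [evRow]⟩
    · exact ⟨6, by simp [evRow]⟩
    · exact ⟨5, by simp [evRow]⟩
    · exact ⟨4, by simp [evRow]⟩
    · exact ⟨3, by simp [evRow]⟩
    · exact ⟨2, by simp [evRow]⟩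
    · exact ⟨1, by simp [evRow]⟩
    · exact ⟨0, by simp [evRow]⟩
  obtain ⟨c, hc⟩ := (Submodule.mem_span_range_iff_exists_fun ℂ).1 hm
  exact ⟨c, by rw [← hc]; simp [smul_eq_C_mul]⟩

open MvPolynomial in
lemma eval_evRow (v : Fin 3 → ℂ) (k : Fin 10) :
    eval v (evRow (R := MvPolynomial (Fin 3) ℂ) X k) = evRow v k := by
  fin_cases k <;> simp [evRow]

open MvPolynomial in
lemma eval_pderiv_evRow (v : Fin 3 → ℂ) (l : Fin 3) (k : Fin 10) :
    eval v (pderiv l (evRow (R := MvPolynomial (Fin 3) ℂ) X k)) = dRow l v k := by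
  fin_cases l <;> fin_cases k <;>
    simp [evRow, dRow, pderiv_X, Derivation.leibniz, Derivation.leibniz_pow] <;> ring

theorem sigma_no_singular_cubic_generic (j : Fin 8) :
    {t : ℂ | ∃ P : MvPolynomial (Fin 3) ℂ, P ≠ 0 ∧ P.IsHomogeneous 3 ∧
        (∀ i : Fin 8, MvPolynomial.eval (sigmaPts i t) P = 0) ∧
        (∀ k : Fin 3, MvPolynomial.eval (sigmaPts j t)
          (MvPolynomial.pderiv k P) = 0)}.Finite := by
  refine (det_finite j).subset ?_
  rintro t ⟨P, hP0, hP, he, hd⟩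
  obtain ⟨c, rfl⟩ := cubic_expand P hP
  have hs : ∀ i, sigmaPts i t = sigR i t := fun i => rfl
  by_contra hdet
  have hdet' : (condMat j t).det ≠ 0 := hdet
  have he' : ∀ i, ∑ k, evRow (sigR i t) k * c k = 0 := by
    intro i
    have := he i
    simp only [map_sum, map_mul, MvPolynomial.eval_C, eval_evRow, hs] at this
    simpa only [mul_comm] using this
  have hd' : ∀ l, ∑ k, dRow l (sigR j t) k * c k = 0 := by
    intro l
    have := hd l
    simp only [map_sum, MvPolynomial.pderiv_C_mul, map_mul, MvPolynomial.smul_eq_C_mul,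
      MvPolynomial.eval_C, eval_pderiv_evRow, hs] at this
    simpa only [mul_comm] using this
  have hv : (condMat j t).mulVec c = 0 := by
    ext r
    simp only [Matrix.mulVec, dotProduct, condMat, Pi.zero_apply]
    split_ifs
    · exact hd' 0
    · exact he' _
    · exact hd' 1
    · exact hd' 2
  have hc := Matrix.eq_zero_of_mulVec_eq_zero hdet' hv
  apply hP0
  simp [hc]
end

section
/- For all but finitely many t ∈ ℂ with t ≠ 0, the eight points of ℙ²(ℂ) represented by σ₁(t), …, σ₈(t) are pairwise distinct and lie in general position, i.e.: (i) no three of them are collinear (for any three distinct indices i, j, k the vectors σ_i(t), σ_j(t), σ_k(t) are linearly independent over ℂ); (ii) no six of them lie on a common conic (for any 6-element subset S, every homogeneous P ∈ ℂ[X, Y, Z] of degree 2 vanishing at σ_i(t) for all i ∈ S is zero); and (iii) no eight of them lie on a cubic with a double point at one of them (there is no nonzero homogeneous P ∈ ℂ[X, Y, Z] of degree 3 with P(σ_i(t)) = 0 for all i ∈ {1, …, 8} whose three partial derivatives all vanish at σ_j(t) for some j ∈ {1, …, 8}). -/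
open Polynomial

/-- The points over an arbitrary commutative semiring. -/
def sg {R : Type} [CommSemiring R] (t : R) (i : Fin 8) : Fin 3 → R :=
  ![![1, t ^ 5, 0],
    ![t ^ 5, 1, 0],
    ![0, 0, 1],
    ![1, t ^ 2, t],
    ![t ^ 2, 1, t],
    ![t, t ^ 2, 1],
    ![1, t ^ 3, 2 * t],
    ![t ^ 4, 1, 2 * t]] i

/-- Exponents of the quadratic monomials. -/
def e2 : Fin 6 → Fin 3 → ℕ := ![![2, 0, 0],
      ![1, 1, 0],
      ![1, 0, 1],
      ![0, 2, 0],
      ![0, 1, 1],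
      ![0, 0, 2]]

/-- Exponents of the cubic monomials. -/
def e3 : Fin 10 → Fin 3 → ℕ := ![![3, 0, 0],
      ![2, 1, 0],
      ![2, 0, 1],
      ![1, 2, 0],
      ![1, 1, 1],
      ![1, 0, 2],
      ![0, 3, 0],
      ![0, 2, 1],
      ![0, 1, 2],
      ![0, 0, 3]]

/-- Values of all the monomials at a point. -/
def erow {R : Type} [CommSemiring R] {m : ℕ} (e : Fin m → Fin 3 → ℕ) (v : Fin 3 → R)
    (j : Fin m) : R :=
  v 0 ^ e j 0 * v 1 ^ e j 1 * v 2 ^ e j 2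

/-- Values of the `k`-th partial derivatives of all the monomials at a point. -/
def prow {R : Type} [CommSemiring R] {m : ℕ} (e : Fin m → Fin 3 → ℕ) (k : Fin 3)
    (v : Fin 3 → R) (j : Fin m) : R :=
  (e j k : R) * (v 0 ^ (e j 0 - if k = 0 then 1 else 0) * v 1 ^ (e j 1 - if k = 1 then 1 else 0)
    * v 2 ^ (e j 2 - if k = 2 then 1 else 0))

/-- The six-element subsets of the eight indices. -/
def sub6 : Fin 28 → Fin 6 → Fin 8 := ![![0, 1, 2, 3, 4, 5],
      ![0, 1, 2, 3, 4, 6],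
      ![0, 1, 2, 3, 4, 7],
      ![0, 1, 2, 3, 5, 6],
      ![0, 1, 2, 3, 5, 7],
      ![0, 1, 2, 3, 6, 7],
      ![0, 1, 2, 4, 5, 6],
      ![0, 1, 2, 4, 5, 7],
      ![0, 1, 2, 4, 6, 7],
      ![0, 1, 2, 5, 6, 7],
      ![0, 1, 3, 4, 5, 6],
      ![0, 1, 3, 4, 5, 7],
      ![0, 1, 3, 4, 6, 7],
      ![0, 1, 3, 5, 6, 7],
      ![0, 1, 4, 5, 6, 7],
      ![0, 2, 3, 4, 5, 6],
      ![0, 2, 3, 4, 5, 7],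
      ![0, 2, 3, 4, 6, 7],
      ![0, 2, 3, 5, 6, 7],
      ![0, 2, 4, 5, 6, 7],
      ![0, 3, 4, 5, 6, 7],
      ![1, 2, 3, 4, 5, 6],
      ![1, 2, 3, 4, 5, 7],
      ![1, 2, 3, 4, 6, 7],
      ![1, 2, 3, 5, 6, 7],
      ![1, 2, 4, 5, 6, 7],
      ![1, 3, 4, 5, 6, 7],
      ![2, 3, 4, 5, 6, 7]]

/-- Conic matrices. -/
def M6 {R : Type} [CommSemiring R] (t : R) (s : Fin 28) : Matrix (Fin 6) (Fin 6) R :=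
  fun i j => erow e2 (sg t (sub6 s i)) j

/-- Singular cubic matrices. -/
def M10 {R : Type} [CommSemiring R] (t : R) (q : Fin 8) : Matrix (Fin 10) (Fin 10) R :=
  fun i j => if h : i.val < 8 then
      (if i.val = q.val then prow e3 0 (sg t q) j else erow e3 (sg t ⟨i.val, h⟩) j)
    else if i.val = 8 then prow e3 1 (sg t q) j else prow e3 2 (sg t q) j

/-- Inverses of the conic matrices at `t = 12` modulo `47`. -/
def B6 : Fin 28 → Fin 6 → Fin 6 → ℕ :=
  ![
    ![![22, 1, 18, 38, 5, 41],
      ![41, 45, 22, 36, 27, 24],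
      ![20, 9, 33, 5, 35, 35],
      ![2, 21, 18, 38, 5, 41],
      ![11, 18, 33, 7, 33, 35],
      ![0, 0, 1, 0, 0, 0]],
    ![![30, 4, 17, 46, 17, 22],
      ![9, 33, 26, 4, 26, 6],
      ![36, 15, 31, 21, 12, 44],
      ![10, 24, 17, 46, 17, 22],
      ![27, 24, 31, 23, 10, 44],
      ![0, 0, 1, 0, 0, 0]],
    ![![15, 41, 16, 8, 28, 21],
      ![22, 26, 30, 15, 29, 10],
      ![6, 42, 29, 39, 34, 42],
      ![42, 14, 16, 8, 28, 21],
      ![44, 4, 29, 41, 32, 42],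
      ![0, 0, 1, 0, 0, 0]],
    ![![3, 35, 38, 19, 15, 30],
      ![23, 3, 36, 18, 34, 21],
      ![28, 12, 32, 13, 41, 22],
      ![30, 8, 38, 19, 15, 30],
      ![36, 45, 24, 32, 42, 10],
      ![0, 0, 1, 0, 0, 0]],
    ![![46, 25, 45, 20, 7, 22],
      ![39, 43, 8, 14, 19, 6],
      ![0, 36, 34, 20, 32, 13],
      ![26, 45, 45, 20, 7, 22],
      ![19, 26, 42, 1, 8, 23],
      ![0, 0, 1, 0, 0, 0]],
    ![![19, 28, 10, 15, 9, 6],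
      ![6, 31, 7, 34, 11, 23],
      ![31, 43, 15, 24, 21, 7],
      ![46, 1, 10, 15, 9, 6],
      ![15, 16, 2, 2, 17, 45],
      ![0, 0, 1, 0, 0, 0]],
    ![![31, 22, 11, 42, 36, 13],
      ![5, 8, 3, 20, 44, 42],
      ![15, 13, 16, 4, 43, 45],
      ![11, 42, 11, 42, 36, 13],
      ![4, 33, 28, 46, 18, 16],
      ![0, 0, 1, 0, 0, 0]],
    ![![10, 36, 28, 31, 11, 36],
      ![42, 46, 29, 17, 3, 44],
      ![11, 0, 17, 31, 36, 27],
      ![37, 9, 28, 31, 11, 36],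
      ![36, 43, 20, 18, 27, 19],
      ![0, 0, 1, 0, 0, 0]],
    ![![44, 29, 43, 13, 30, 18],
      ![0, 27, 16, 42, 21, 22],
      ![24, 7, 2, 2, 17, 45],
      ![24, 2, 43, 13, 30, 18],
      ![34, 13, 44, 8, 1, 9],
      ![0, 0, 1, 0, 0, 0]],
    ![![32, 37, 46, 26, 36, 5],
      ![1, 42, 4, 37, 44, 27],
      ![33, 1, 35, 4, 36, 43],
      ![12, 10, 46, 26, 36, 5],
      ![23, 36, 35, 16, 30, 1],
      ![0, 0, 1, 0, 0, 0]],
    ![![25, 8, 41, 33, 8, 20],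
      ![29, 17, 24, 9, 15, 14],
      ![2, 14, 34, 8, 45, 21],
      ![5, 28, 41, 33, 8, 20],
      ![40, 23, 36, 6, 45, 21],
      ![8, 3, 8, 12, 6, 22]],
    ![![6, 32, 3, 24, 1, 1],
      ![11, 15, 35, 45, 43, 43],
      ![22, 11, 27, 15, 40, 41],
      ![33, 5, 3, 24, 1, 1],
      ![13, 20, 29, 13, 40, 41],
      ![20, 20, 32, 35, 3, 34]],
    ![![10, 22, 11, 16, 24, 28],
      ![42, 8, 3, 30, 45, 29],
      ![41, 34, 18, 24, 20, 40],
      ![37, 42, 11, 16, 24, 28],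
      ![32, 43, 20, 22, 20, 40],
      ![32, 37, 9, 11, 25, 21]],
    ![![18, 2, 27, 45, 25, 35],
      ![10, 41, 33, 8, 41, 1],
      ![6, 4, 42, 44, 45, 27],
      ![45, 22, 27, 45, 25, 35],
      ![43, 39, 42, 9, 39, 32],
      ![14, 35, 20, 28, 11, 17]],
    ![![28, 24, 27, 19, 38, 32],
      ![17, 0, 33, 18, 36, 13],
      ![32, 33, 42, 14, 13, 38],
      ![8, 44, 27, 19, 38, 32],
      ![22, 21, 42, 26, 7, 43],
      ![4, 13, 20, 7, 45, 20]],
    ![![35, 34, 4, 1, 39, 24],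
      ![15, 37, 10, 35, 28, 46],
      ![43, 36, 28, 46, 17, 28],
      ![40, 25, 29, 15, 46, 34],
      ![10, 39, 6, 8, 46, 9],
      ![0, 1, 0, 0, 0, 0]],
    ![![21, 11, 27, 15, 15, 3],
      ![43, 36, 11, 7, 29, 41],
      ![11, 17, 0, 31, 36, 27],
      ![28, 12, 42, 27, 12, 16],
      ![40, 1, 44, 25, 37, 7],
      ![0, 1, 0, 0, 0, 0]],
    ![![24, 26, 12, 12, 32, 46],
      ![30, 18, 29, 20, 18, 27],
      ![37, 6, 11, 5, 11, 8],
      ![21, 24, 30, 34, 35, 41],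
      ![38, 38, 7, 27, 10, 41],
      ![0, 1, 0, 0, 0, 0]],
    ![![36, 39, 46, 34, 19, 30],
      ![3, 24, 23, 41, 12, 16],
      ![42, 31, 33, 22, 33, 17],
      ![8, 6, 1, 18, 6, 27],
      ![18, 32, 13, 6, 16, 5],
      ![0, 1, 0, 0, 0, 0]],
    ![![17, 38, 19, 35, 20, 24],
      ![17, 0, 33, 18, 36, 13],
      ![11, 17, 31, 36, 0, 27],
      ![27, 7, 28, 17, 5, 33],
      ![30, 45, 35, 40, 3, 36],
      ![0, 1, 0, 0, 0, 0]],
    ![![0, 38, 36, 26, 11, 31],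
      ![17, 0, 33, 18, 36, 13],
      ![17, 17, 25, 6, 17, 19],
      ![35, 7, 20, 24, 12, 38],
      ![21, 45, 44, 38, 1, 1],
      ![28, 1, 19, 1, 1, 41]],
    ![![28, 9, 16, 19, 1, 10],
      ![12, 33, 42, 36, 5, 40],
      ![25, 12, 32, 5, 20, 39],
      ![32, 30, 36, 2, 16, 18],
      ![8, 5, 43, 40, 15, 5],
      ![0, 1, 0, 0, 0, 0]],
    ![![26, 5, 31, 37, 33, 19],
      ![4, 17, 8, 14, 39, 29],
      ![36, 34, 20, 0, 32, 13],
      ![19, 4, 16, 25, 36, 6],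
      ![7, 3, 27, 2, 31, 33],
      ![0, 1, 0, 0, 0, 0]],
    ![![31, 15, 17, 39, 25, 42],
      ![27, 16, 0, 42, 21, 22],
      ![38, 38, 5, 29, 10, 41],
      ![33, 32, 5, 40, 23, 14],
      ![6, 1, 11, 11, 42, 19],
      ![0, 1, 0, 0, 0, 0]],
    ![![4, 8, 8, 9, 31, 40],
      ![16, 41, 12, 35, 13, 9],
      ![36, 34, 20, 32, 0, 13],
      ![27, 20, 3, 2, 40, 24],
      ![2, 40, 41, 17, 22, 10],
      ![0, 1, 0, 0, 0, 0]],
    ![![27, 7, 28, 17, 5, 33],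
      ![27, 16, 42, 0, 21, 22],
      ![23, 8, 23, 5, 29, 19],
      ![18, 2, 34, 5, 42, 39],
      ![20, 29, 26, 11, 18, 27],
      ![0, 1, 0, 0, 0, 0]],
    ![![0, 38, 36, 26, 11, 31],
      ![19, 13, 20, 34, 28, 4],
      ![19, 30, 12, 22, 9, 10],
      ![17, 31, 43, 21, 37, 25],
      ![29, 3, 39, 8, 16, 12],
      ![23, 39, 28, 8, 21, 40]],
    ![![0, 38, 36, 26, 11, 31],
      ![9, 38, 3, 9, 27, 20],
      ![9, 8, 42, 44, 8, 26],
      ![13, 41, 8, 11, 46, 22],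
      ![36, 9, 18, 2, 12, 29],
      ![1, 0, 0, 0, 0, 0]]]

/-- Inverses of the cubic matrices at `t = 12` modulo `47`. -/
def B10 : Fin 8 → Fin 10 → Fin 10 → ℕ :=
  ![
    ![![8, 13, 34, 5, 1, 13, 26, 32, 45, 35],
      ![22, 35, 16, 30, 6, 31, 15, 4, 27, 22],
      ![4, 32, 20, 25, 34, 6, 29, 20, 11, 4],
      ![20, 43, 37, 40, 8, 10, 20, 21, 12, 45],
      ![5, 35, 45, 8, 2, 20, 29, 2, 32, 26],
      ![36, 13, 35, 22, 25, 18, 11, 35, 45, 24],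
      ![11, 13, 11, 3, 10, 36, 25, 38, 28, 21],
      ![26, 17, 1, 24, 4, 23, 22, 41, 19, 7],
      ![2, 10, 26, 29, 33, 12, 44, 32, 37, 45],
      ![0, 0, 1, 0, 0, 0, 0, 0, 0, 0]],
    ![![6, 26, 12, 8, 19, 45, 13, 27, 38, 6],
      ![28, 1, 19, 44, 34, 36, 1, 31, 4, 33],
      ![3, 6, 4, 45, 25, 41, 42, 24, 44, 2],
      ![12, 7, 26, 33, 2, 27, 36, 35, 10, 13],
      ![41, 21, 15, 15, 45, 8, 37, 30, 36, 3],
      ![34, 9, 28, 29, 14, 33, 17, 36, 27, 33],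
      ![17, 26, 20, 29, 16, 28, 6, 45, 6, 10],
      ![13, 34, 40, 41, 16, 30, 39, 46, 37, 37],
      ![46, 25, 37, 21, 7, 41, 29, 25, 21, 24],
      ![0, 0, 1, 0, 0, 0, 0, 0, 0, 0]],
    ![![32, 44, 29, 5, 2, 37, 17, 3, 25, 36],
      ![23, 36, 4, 44, 1, 32, 35, 43, 37, 14],
      ![21, 2, 29, 22, 17, 32, 43, 12, 17, 38],
      ![18, 44, 19, 31, 13, 22, 28, 18, 41, 15],
      ![13, 38, 37, 43, 35, 10, 22, 2, 8, 31],
      ![0, 0, 1, 0, 0, 0, 0, 0, 0, 0],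
      ![22, 44, 26, 17, 9, 39, 9, 8, 43, 17],
      ![25, 25, 26, 23, 7, 36, 27, 22, 3, 0],
      ![0, 0, 0, 0, 0, 0, 0, 0, 1, 0],
      ![0, 0, 0, 0, 0, 0, 0, 0, 0, 16]],
    ![![39, 21, 4, 35, 15, 43, 30, 21, 3, 0],
      ![4, 27, 27, 4, 14, 24, 30, 24, 5, 12],
      ![6, 10, 26, 16, 21, 26, 24, 3, 43, 28],
      ![36, 2, 20, 23, 1, 11, 41, 12, 29, 46],
      ![2, 3, 0, 16, 1, 28, 37, 45, 19, 27],
      ![8, 38, 3, 7, 9, 37, 44, 36, 33, 42],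
      ![31, 37, 43, 3, 27, 8, 9, 14, 17, 12],
      ![18, 32, 25, 7, 27, 39, 8, 34, 44, 24],
      ![38, 2, 45, 7, 7, 25, 4, 21, 3, 5],
      ![0, 0, 1, 0, 0, 0, 0, 0, 0, 0]],
    ![![6, 26, 23, 45, 32, 37, 44, 30, 7, 46],
      ![39, 34, 29, 7, 34, 5, 37, 33, 40, 26],
      ![4, 39, 28, 2, 15, 21, 28, 13, 17, 1],
      ![15, 40, 9, 2, 42, 36, 38, 29, 17, 5],
      ![45, 13, 0, 8, 2, 13, 10, 7, 23, 44],
      ![10, 44, 0, 33, 30, 29, 43, 35, 25, 6],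
      ![28, 17, 27, 46, 21, 12, 25, 12, 21, 22],
      ![29, 38, 18, 34, 0, 1, 21, 37, 14, 6],
      ![40, 46, 6, 31, 4, 19, 17, 15, 17, 19],
      ![0, 0, 1, 0, 0, 0, 0, 0, 0, 0]],
    ![![2, 4, 29, 8, 26, 0, 19, 41, 16, 42],
      ![37, 43, 1, 28, 2, 42, 3, 37, 33, 14],
      ![23, 15, 33, 35, 43, 1, 7, 45, 42, 30],
      ![36, 5, 31, 3, 25, 20, 32, 36, 4, 19],
      ![46, 45, 15, 22, 25, 0, 33, 24, 44, 22],
      ![17, 41, 8, 34, 29, 16, 45, 3, 17, 7],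
      ![10, 32, 23, 13, 12, 42, 32, 13, 3, 41],
      ![32, 43, 9, 22, 20, 41, 1, 2, 14, 4],
      ![43, 11, 12, 34, 35, 15, 40, 30, 2, 15],
      ![0, 0, 1, 0, 0, 0, 0, 0, 0, 0]],
    ![![20, 45, 25, 14, 32, 28, 31, 24, 7, 36],
      ![19, 9, 10, 17, 10, 6, 3, 24, 34, 26],
      ![44, 30, 6, 33, 0, 29, 6, 26, 6, 10],
      ![26, 43, 8, 4, 44, 26, 40, 14, 41, 14],
      ![21, 16, 20, 9, 36, 29, 26, 17, 41, 20],
      ![38, 23, 38, 22, 14, 21, 25, 18, 16, 39],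
      ![17, 21, 16, 26, 44, 24, 33, 26, 15, 29],
      ![7, 43, 28, 42, 42, 4, 43, 5, 29, 37],
      ![25, 26, 9, 35, 0, 11, 14, 42, 45, 41],
      ![0, 0, 1, 0, 0, 0, 0, 0, 0, 0]],
    ![![41, 1, 21, 24, 9, 28, 39, 40, 26, 44],
      ![22, 44, 32, 38, 27, 38, 19, 5, 23, 3],
      ![13, 22, 40, 19, 36, 2, 45, 16, 17, 46],
      ![28, 46, 27, 5, 39, 39, 44, 38, 35, 33],
      ![44, 5, 34, 23, 19, 15, 43, 2, 24, 3],
      ![8, 44, 14, 23, 38, 11, 14, 29, 2, 13],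
      ![10, 21, 22, 40, 16, 9, 34, 24, 33, 38],
      ![22, 35, 36, 30, 27, 42, 46, 46, 9, 35],
      ![8, 45, 16, 38, 22, 32, 26, 24, 25, 44],
      ![0, 0, 1, 0, 0, 0, 0, 0, 0, 0]]]

theorem check6 : ∀ s i j, (∑ k, B6 s i k * M6 12 s k j) % 47 = if i = j then 1 else 0 := by
  decide +kernel

theorem check10 : ∀ s i j, (∑ k, B10 s i k * M10 12 s k j) % 47 = if i = j then 1 else 0 := by
  decide +kernel

theorem sub6_cover : ∀ T : Finset (Fin 8), T.card = 6 → ∃ s, ∀ i, sub6 s i ∈ T := by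
  decide +kernel

theorem check3 : ∀ i j k : Fin 8, i ≠ j → i ≠ k → j ≠ k →
    sg (2 : ℤ) i 0 * sg 2 j 1 * sg 2 k 2 - sg (2 : ℤ) i 0 * sg 2 j 2 * sg 2 k 1
    - sg (2 : ℤ) i 1 * sg 2 j 0 * sg 2 k 2 + sg (2 : ℤ) i 1 * sg 2 j 2 * sg 2 k 0
    + sg (2 : ℤ) i 2 * sg 2 j 0 * sg 2 k 1 - sg (2 : ℤ) i 2 * sg 2 j 1 * sg 2 k 0 ≠ 0 := by
  decide +kernel


theorem sg_map {R S : Type} [CommSemiring R] [CommSemiring S] (φ : R →+* S) (t : R) (i : Fin 8)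
    (k : Fin 3) : φ (sg t i k) = sg (φ t) i k := by
  fin_cases i <;> fin_cases k <;> simp [sg, map_ofNat φ 2]

theorem erow_map {R S : Type} [CommSemiring R] [CommSemiring S] (φ : R →+* S) {m : ℕ}
    (e : Fin m → Fin 3 → ℕ) (t : R) (i : Fin 8) (j : Fin m) :
    φ (erow e (sg t i) j) = erow e (sg (φ t) i) j := by
  simp [erow, sg_map]

theorem prow_map {R S : Type} [CommSemiring R] [CommSemiring S] (φ : R →+* S) {m : ℕ}
    (e : Fin m → Fin 3 → ℕ) (k : Fin 3) (t : R) (i : Fin 8) (j : Fin m) :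
    φ (prow e k (sg t i) j) = prow e k (sg (φ t) i) j := by
  simp [prow, sg_map]

theorem M6_map {R S : Type} [CommSemiring R] [CommSemiring S] (φ : R →+* S) (t : R) (s : Fin 28) :
    (M6 t s).map φ = M6 (φ t) s := by
  ext i j
  simp [M6, erow_map]

theorem M10_map {R S : Type} [CommSemiring R] [CommSemiring S] (φ : R →+* S) (t : R) (s : Fin 8) :
    (M10 t s).map φ = M10 (φ t) s := by
  ext i j
  simp only [M10, Matrix.map_apply]
  split_ifs <;> simp [erow_map, prow_map]

/-- The three-point matrices. -/
def M3 {R : Type} [CommSemiring R] (t : R) (i j k : Fin 8) : Matrix (Fin 3) (Fin 3) R :=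
  ![sg t i, sg t j, sg t k]

theorem M3_map {R S : Type} [CommSemiring R] [CommSemiring S] (φ : R →+* S) (t : R)
    (i j k : Fin 8) : (M3 t i j k).map φ = M3 (φ t) i j k := by
  ext a b
  fin_cases a <;> exact sg_map φ t _ b

/-- A polynomial matrix with nonzero determinant is singular for finitely many parameters only. -/
theorem finite_of_det_ne {n : ℕ} (M : Matrix (Fin n) (Fin n) ℤ[X]) (h : M.det ≠ 0) :
    {t : ℂ | (M.map (Polynomial.eval₂RingHom (Int.castRingHom ℂ) t)).det = 0}.Finite := by
  have h' : M.det.map (Int.castRingHom ℂ) ≠ 0 := by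
    rwa [Ne, Polynomial.map_eq_zero_iff (RingHom.injective_int _)]
  refine (Polynomial.finite_setOfPred_isRoot h').subset ?_
  intro t ht
  have : (Polynomial.eval₂RingHom (Int.castRingHom ℂ) t) M.det = 0 := by
    rw [RingHom.map_det]; exact ht
  simpa [Polynomial.IsRoot, Polynomial.eval_map] using this

/-- An inverse modulo `47` of a specialization certifies that a determinant is nonzero. -/
theorem det_ne_of_cert {n : ℕ} (M : Matrix (Fin n) (Fin n) ℤ[X]) (M0 : Matrix (Fin n) (Fin n) ℕ)
    (B : Fin n → Fin n → ℕ) (φ : ℤ[X] →+* ZMod 47)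
    (hM : M.map φ = M0.map (Nat.castRingHom (ZMod 47)))
    (h : ∀ i j, (∑ k, B i k * M0 k j) % 47 = if i = j then 1 else 0) : M.det ≠ 0 := by
  intro h0
  have h1 : (M0.map (Nat.castRingHom (ZMod 47))).det = 0 := by
    rw [← hM]
    change (φ.mapMatrix M).det = 0
    rw [← RingHom.map_det, h0, map_zero]
  have h2 : (Matrix.of B).map (Nat.castRingHom (ZMod 47)) * M0.map (Nat.castRingHom (ZMod 47))
      = 1 := by
    rw [← Matrix.map_mul]
    ext i j
    have := congrArg (fun x : ℕ => (x : ZMod 47)) (h i j)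
    simp only [ZMod.natCast_mod] at this
    rw [Matrix.map_apply, Matrix.mul_apply]
    change ((∑ k, B i k * M0 k j : ℕ) : ZMod 47) = _
    rw [this, Matrix.one_apply]
    split_ifs <;> simp
  have h3 := congrArg Matrix.det h2
  rw [Matrix.det_mul, h1, mul_zero, Matrix.det_one] at h3
  exact absurd h3 (by decide)

/-- Specialization at `12` modulo `47`. -/
noncomputable def spec : ℤ[X] →+* ZMod 47 :=
  Polynomial.eval₂RingHom (Int.castRingHom (ZMod 47)) 12

theorem spec_X : spec X = Nat.castRingHom (ZMod 47) 12 := by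
  simp [spec]

theorem fin6 (s : Fin 28) : {t : ℂ | (M6 t s).det = 0}.Finite := by
  have := finite_of_det_ne (M6 X s) (det_ne_of_cert _ (M6 12 s) (B6 s) spec
    (by rw [M6_map, M6_map, spec_X]) (check6 s))
  simp only [M6_map] at this
  simpa only [Polynomial.coe_eval₂RingHom, Polynomial.eval₂_X] using this

theorem fin10 (s : Fin 8) : {t : ℂ | (M10 t s).det = 0}.Finite := by
  have := finite_of_det_ne (M10 X s) (det_ne_of_cert _ (M10 12 s) (B10 s) spec
    (by rw [M10_map, M10_map, spec_X]) (check10 s))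
  simp only [M10_map] at this
  simpa only [Polynomial.coe_eval₂RingHom, Polynomial.eval₂_X] using this

theorem fin3 (i j k : Fin 8) (hij : i ≠ j) (hik : i ≠ k) (hjk : j ≠ k) :
    {t : ℂ | (M3 t i j k).det = 0}.Finite := by
  have := finite_of_det_ne (M3 X i j k) (by
    intro h0
    have h1 := congrArg (Polynomial.evalRingHom (2 : ℤ)) h0
    rw [RingHom.map_det, map_zero] at h1
    change ((M3 X i j k).map (Polynomial.evalRingHom (2 : ℤ))).det = 0 at h1
    rw [M3_map, Polynomial.coe_evalRingHom, Polynomial.eval_X, Matrix.det_fin_three] at h1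
    exact check3 i j k hij hik hjk h1)
  simp only [M3_map] at this
  simpa only [Polynomial.coe_eval₂RingHom, Polynomial.eval₂_X] using this

theorem e2_inj : Function.Injective e2 := by decide +kernel

theorem e3_inj : Function.Injective e3 := by decide +kernel

theorem e2_cover (a b c : ℕ) (h : a + b + c = 2) : ∃ j, e2 j = ![a, b, c] := by
  have ha : a ≤ 2 := by omega
  have hb : b ≤ 2 := by omega
  obtain rfl : c = 2 - a - b := by omega
  interval_cases a <;> interval_cases b <;> first | omega | decide +kernel

theorem e3_cover (a b c : ℕ) (h : a + b + c = 3) : ∃ j, e3 j = ![a, b, c] := by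
  have ha : a ≤ 3 := by omega
  have hb : b ≤ 3 := by omega
  obtain rfl : c = 3 - a - b := by omega
  interval_cases a <;> interval_cases b <;> first | omega | decide +kernel

/-- A homogeneous polynomial is the combination of the listed monomials. -/
theorem expand {m n : ℕ} (e : Fin m → Fin 3 → ℕ) (he : Function.Injective e)
    (hc : ∀ a b c, a + b + c = n → ∃ j, e j = ![a, b, c])
    (P : MvPolynomial (Fin 3) ℂ) (hP : P.IsHomogeneous n) :
    P = ∑ j, MvPolynomial.monomial (Finsupp.equivFunOnFinite.symm (e j))
      (P.coeff (Finsupp.equivFunOnFinite.symm (e j))) := by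
  classical
  ext d
  simp only [MvPolynomial.coeff_sum, MvPolynomial.coeff_monomial]
  by_cases hd : P.coeff d = 0
  · rw [hd, Finset.sum_eq_zero]
    intro j _
    split_ifs with h
    · rw [h, hd]
    · rfl
  · have h1 : d.degree = n := by
      by_contra hne
      exact hd (hP.coeff_eq_zero hne)
    obtain ⟨j, hj⟩ := hc (d 0) (d 1) (d 2) (by
      rw [← h1, Finsupp.degree_eq_sum, Fin.sum_univ_three])
    have hj' : Finsupp.equivFunOnFinite.symm (e j) = d := by
      ext x
      rw [hj]
      fin_cases x <;> simp
    rw [Finset.sum_eq_single j]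
    · rw [if_pos hj', hj']
    · intro b _ hb
      rw [if_neg]
      intro h
      exact hb (he (Finsupp.equivFunOnFinite.symm.injective (h.trans hj'.symm)))
    · simp

theorem eval_row {m : ℕ} (e : Fin m → Fin 3 → ℕ) (c : Fin m → ℂ) (v : Fin 3 → ℂ) :
    MvPolynomial.eval v (∑ j, MvPolynomial.monomial (Finsupp.equivFunOnFinite.symm (e j)) (c j))
      = ∑ j, erow e v j * c j := by
  rw [map_sum]
  refine Finset.sum_congr rfl fun j _ => ?_
  rw [MvPolynomial.eval_monomial, Finsupp.prod_fintype _ _ (by simp), Fin.prod_univ_three]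
  simp [erow, mul_comm]

theorem eval_prow {m : ℕ} (e : Fin m → Fin 3 → ℕ) (c : Fin m → ℂ) (v : Fin 3 → ℂ) (k : Fin 3) :
    MvPolynomial.eval v (MvPolynomial.pderiv k
      (∑ j, MvPolynomial.monomial (Finsupp.equivFunOnFinite.symm (e j)) (c j)))
      = ∑ j, prow e k v j * c j := by
  rw [map_sum, map_sum]
  refine Finset.sum_congr rfl fun j _ => ?_
  rw [MvPolynomial.pderiv_monomial, MvPolynomial.eval_monomial,
    Finsupp.prod_fintype _ _ (by simp), Fin.prod_univ_three]
  simp only [prow, Finsupp.tsub_apply, Finsupp.single_apply, Finsupp.equivFunOnFinite_symm_apply_apply]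
  ring

theorem sg_eq (i : Fin 8) (t : ℂ) : sigmaPts i t = sg t i := rfl

theorem conic {t : ℂ} (h : ∀ s, (M6 t s).det ≠ 0) (f : Fin 6 → Fin 8) (hf : Function.Injective f)
    (P : MvPolynomial (Fin 3) ℂ) (hP : P.IsHomogeneous 2)
    (h0 : ∀ i, MvPolynomial.eval (sg t (f i)) P = 0) : P = 0 := by
  obtain ⟨s, hs⟩ := sub6_cover (Finset.univ.image f) (by
    rw [Finset.card_image_of_injective _ hf]; simp)
  have hx := expand e2 e2_inj e2_cover P hP
  have hv : (M6 t s).mulVec (fun j => P.coeff (Finsupp.equivFunOnFinite.symm (e2 j))) = 0 := by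
    funext i
    obtain ⟨a, -, ha⟩ := Finset.mem_image.1 (hs i)
    have := h0 a
    rw [hx, eval_row, ha] at this
    exact this
  have hz := Matrix.eq_zero_of_mulVec_eq_zero (h s) hv
  rw [hx]
  exact Finset.sum_eq_zero fun j _ => by
    have := congrFun hz j
    simp only [Pi.zero_apply] at this
    rw [this, map_zero]

theorem cubic {t : ℂ} (h : ∀ s, (M10 t s).det ≠ 0) (q : Fin 8)
    (P : MvPolynomial (Fin 3) ℂ) (hP : P.IsHomogeneous 3)
    (h0 : ∀ i, MvPolynomial.eval (sg t i) P = 0)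
    (h1 : ∀ k, MvPolynomial.eval (sg t q) (MvPolynomial.pderiv k P) = 0) : P = 0 := by
  have hx := expand e3 e3_inj e3_cover P hP
  have hv : (M10 t q).mulVec (fun j => P.coeff (Finsupp.equivFunOnFinite.symm (e3 j))) = 0 := by
    rw [hx] at h0 h1
    simp only [eval_row] at h0
    simp only [eval_prow] at h1
    funext i
    simp only [Matrix.mulVec, dotProduct, M10, Pi.zero_apply]
    split_ifs
    · exact h1 0
    · exact h0 _
    · exact h1 1
    · exact h1 2
  have hz := Matrix.eq_zero_of_mulVec_eq_zero (h q) hv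
  rw [hx]
  exact Finset.sum_eq_zero fun j _ => by
    have := congrFun hz j
    simp only [Pi.zero_apply] at this
    rw [this, map_zero]

theorem third_index : ∀ i j : Fin 8, ∃ k, i ≠ k ∧ j ≠ k := by decide +kernel

/-- For all but finitely many `t ∈ ℂ` with `t ≠ 0`, the eight points of `ℙ²(ℂ)` represented
by `σ₁(t), …, σ₈(t)` are pairwise distinct and in general position:
(i) no three are collinear; (ii) no six lie on a common conic; (iii) no cubic passes through
all eight with a double point at one of them. -/
theorem sigma_general_position_generic :
    {t : ℂ | t ≠ 0 ∧ ¬ (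
      -- the eight projective points are pairwise distinct
      (∀ i j : Fin 8, i ≠ j → ∀ c : ℂ, sigmaPts i t ≠ c • sigmaPts j t) ∧
      -- (i) no three collinear
      (∀ i j k : Fin 8, i ≠ j → i ≠ k → j ≠ k →
        LinearIndependent ℂ ![sigmaPts i t, sigmaPts j t, sigmaPts k t]) ∧
      -- (ii) no six on a common conic
      (∀ f : Fin 6 → Fin 8, Function.Injective f →
        ∀ P : MvPolynomial (Fin 3) ℂ, P.IsHomogeneous 2 →
          (∀ i : Fin 6, MvPolynomial.eval (sigmaPts (f i) t) P = 0) → P = 0) ∧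
      -- (iii) no cubic through all eight points with a double point at one of them
      (¬ ∃ j : Fin 8, ∃ P : MvPolynomial (Fin 3) ℂ, P ≠ 0 ∧ P.IsHomogeneous 3 ∧
        (∀ i : Fin 8, MvPolynomial.eval (sigmaPts i t) P = 0) ∧
        (∀ k : Fin 3, MvPolynomial.eval (sigmaPts j t)
          (MvPolynomial.pderiv k P) = 0)))}.Finite := by
  have hA : (⋃ p : {p : Fin 8 × Fin 8 × Fin 8 // p.1 ≠ p.2.1 ∧ p.1 ≠ p.2.2 ∧ p.2.1 ≠ p.2.2},
      {t : ℂ | (M3 t p.1.1 p.1.2.1 p.1.2.2).det = 0}).Finite :=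
    Set.finite_iUnion fun p => fin3 _ _ _ p.2.1 p.2.2.1 p.2.2.2
  refine ((hA.union (Set.finite_iUnion fin6)).union (Set.finite_iUnion fin10)).subset ?_
  rintro t ⟨-, ht⟩
  by_contra hn
  simp only [Set.mem_union, Set.mem_iUnion, Set.mem_ofPred_eq, not_or, not_exists] at hn
  obtain ⟨⟨h3, h6⟩, h10⟩ := hn
  have hli : ∀ i j k : Fin 8, i ≠ j → i ≠ k → j ≠ k →
      LinearIndependent ℂ ![sigmaPts i t, sigmaPts j t, sigmaPts k t] := by
    intro i j k hij hik hjk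
    have := Matrix.linearIndependent_rows_of_det_ne_zero (h3 ⟨(i, j, k), hij, hik, hjk⟩)
    exact this
  refine ht ⟨?_, hli, ?_, ?_⟩
  · intro i j hij c hc
    obtain ⟨k, hik, hjk⟩ := third_index i j
    have := Fintype.linearIndependent_iff.1 (hli i j k hij hik hjk) ![1, -c, 0] (by
      simp [Fin.sum_univ_three, hc]) 0
    simp at this
  · intro f hf P hP h0
    exact conic h6 f hf P hP h0
  · rintro ⟨q, P, hne, hP, h0, h1⟩
    exact hne (cubic h10 q P hP h0 h1)
end
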